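/- Let K be a field. Let B_2(K) ⊆ GL_2(K) and B_2(K[X]) ⊆ GL_2(K[X]) denote the subgroups of lower triangular invertible matrices. Then the natural homomorphism from the amalgamated free product GL_2(K) *_{B_2(K)} B_2(K[X]) to GL_2(K[X]) induced by the inclusions is an isomorphism, i.e., GL_2(K[X]) = GL_2(K) *_{B_2(K)} B_2(K[X]) (Nagao's theorem). -/

import Mathlib

open MvPolynomial

noncomputable section


/-- The subgroup `GL₂(K) ⊆ GL₂(K[X])` (matrices with constant entries). -/
def GLconst (K : Type*) [Field K] : Subgroup (GL (Fin 2) (Polynomial K)) :=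
  (Matrix.GeneralLinearGroup.map (Polynomial.C : K →+* Polynomial K)).range

/-- The subgroup `B₂(K[X]) ⊆ GL₂(K[X])` of invertible lower triangular matrices. -/
def LowerTri (K : Type*) [Field K] : Subgroup (GL (Fin 2) (Polynomial K)) where
  carrier := {M | (M : Matrix (Fin 2) (Fin 2) (Polynomial K)) 0 1 = 0}
  one_mem' := by
    simp [Matrix.one_apply]
  mul_mem' := by
    intro a b ha hb
    simp only [Set.mem_setOf_eq, Units.val_mul, Matrix.mul_apply, Fin.sum_univ_two] at *
    rw [ha, hb]
    ring
  inv_mem' := by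
    intro a ha
    simp only [Set.mem_setOf_eq] at *
    rw [Matrix.coe_units_inv, Matrix.inv_def]
    simp [Matrix.adjugate_fin_two, ha]

/-- The amalgamated free product `A *_C B` of two groups along injective homomorphisms
`f : C → A`, `g : C → B`: the pushout of `f` and `g` in the category of groups, realized as
the quotient of the free product `A * B` by the relations identifying `f(c)` and `g(c)`. -/
abbrev Amal {A B C : Type*} [Group A] [Group B] [Group C] (f : C →* A) (g : C →* B) :=
  Monoid.Coprod A B ⧸ Subgroup.normalClosure
    {w | ∃ c : C, w = Monoid.Coprod.inl (f c) * (Monoid.Coprod.inr (g c))⁻¹}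

section Amalgam

variable {G P : Type*} [Group G] [Group P] {A B : Subgroup G}

/-- Elements of `P` that are products of letters taken alternately from `A \ B` and `B \ A`, apart
from an arbitrary leading letter from `B`, with at least one letter from `A \ B`. The flag is `true`
if the last letter comes from `A`. -/
inductive IsAlternating (i : A →* P) (j : B →* P) : Bool → P → Prop
  | base (b : B) (a : A) (ha : (a : G) ∉ B) : IsAlternating i j true (j b * i a)
  | snocLeft {p : P} (hp : IsAlternating i j false p) (a : A) (ha : (a : G) ∉ B) :
      IsAlternating i j true (p * i a)
  | snocRight {p : P} (hp : IsAlternating i j true p) (b : B) (hb : (b : G) ∉ A) :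
      IsAlternating i j false (p * j b)

/-- Elements of `P` that lie in the image of `B` or are alternating products. -/
def HasNormalForm (i : A →* P) (j : B →* P) (p : P) : Prop :=
  (∃ b, p = j b) ∨ ∃ s, IsAlternating i j s p

variable {i : A →* P} {j : B →* P}

theorem IsAlternating.mul_left_of_mem
    (hij : ∀ (a : A) (b : B), (a : G) = b → i a = j b) {s : Bool} {p : P}
    (hp : IsAlternating i j s p) (a : A) (ha : (a : G) ∈ B) : IsAlternating i j s (p * i a) := by
  cases hp with
  | base b a' ha' =>
    rw [mul_assoc, ← map_mul]
    exact .base b _ fun h => ha' ((B.mul_mem_cancel_right ha).1 h)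
  | snocLeft hp a' ha' =>
    rw [mul_assoc, ← map_mul]
    exact .snocLeft hp _ fun h => ha' ((B.mul_mem_cancel_right ha).1 h)
  | snocRight hp b hb =>
    rw [hij a ⟨a, ha⟩ rfl, mul_assoc, ← map_mul]
    exact .snocRight hp _ fun h => hb ((A.mul_mem_cancel_right a.2).1 h)

theorem HasNormalForm.mul_left
    (hij : ∀ (a : A) (b : B), (a : G) = b → i a = j b) {p : P}
    (hp : HasNormalForm i j p) (a : A) : HasNormalForm i j (p * i a) := by
  by_cases ha : (a : G) ∈ B
  · rcases hp with ⟨b, rfl⟩ | ⟨s, hp⟩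
    · exact .inl ⟨b * ⟨a, ha⟩, by rw [map_mul, hij a ⟨a, ha⟩ rfl]⟩
    · exact .inr ⟨s, hp.mul_left_of_mem hij a ha⟩
  · rcases hp with ⟨b, rfl⟩ | ⟨s, hp⟩
    · exact .inr ⟨_, .base b a ha⟩
    · cases hp with
      | base b a' ha' =>
        rw [mul_assoc, ← map_mul]
        by_cases h : ((a' * a : A) : G) ∈ B
        · exact .inl ⟨b * ⟨_, h⟩, by rw [map_mul j, ← hij (a' * a) ⟨_, h⟩ rfl]⟩
        · exact .inr ⟨_, .base b _ h⟩
      | snocLeft hp a' ha' =>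
        rw [mul_assoc, ← map_mul]
        by_cases h : ((a' * a : A) : G) ∈ B
        · exact .inr ⟨_, hp.mul_left_of_mem hij _ h⟩
        · exact .inr ⟨_, .snocLeft hp _ h⟩
      | snocRight hp b hb => exact .inr ⟨_, .snocLeft (.snocRight hp b hb) a ha⟩

theorem HasNormalForm.mul_right
    (hij : ∀ (a : A) (b : B), (a : G) = b → i a = j b) {p : P}
    (hp : HasNormalForm i j p) (b : B) : HasNormalForm i j (p * j b) := by
  by_cases hb : (b : G) ∈ A
  · rw [← hij ⟨b, hb⟩ b rfl]
    exact hp.mul_left hij _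
  · rcases hp with ⟨b', rfl⟩ | ⟨s, hp⟩
    · exact .inl ⟨b' * b, by rw [map_mul]⟩
    · cases hp with
      | base b' a ha => exact .inr ⟨_, .snocRight (.base b' a ha) b hb⟩
      | snocLeft hp a ha => exact .inr ⟨_, .snocRight (.snocLeft hp a ha) b hb⟩
      | snocRight hp b' hb' =>
        rw [mul_assoc, ← map_mul]
        by_cases h : ((b' * b : B) : G) ∈ A
        · rw [← hij ⟨_, h⟩ _ rfl]
          exact .inr ⟨_, hp.mul_left_of_mem hij _ (b' * b).2⟩
        · exact .inr ⟨_, .snocRight hp _ h⟩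

theorem hasNormalForm_coprod (φ : Monoid.Coprod A B →* P)
    (hij : ∀ (a : A) (b : B), (a : G) = b → φ (Monoid.Coprod.inl a) = φ (Monoid.Coprod.inr b)) (w : Monoid.Coprod A B) :
    HasNormalForm (φ.comp Monoid.Coprod.inl) (φ.comp Monoid.Coprod.inr) (φ w) := by
  suffices h : ∀ p, HasNormalForm (φ.comp Monoid.Coprod.inl) (φ.comp Monoid.Coprod.inr) p →
      HasNormalForm (φ.comp Monoid.Coprod.inl) (φ.comp Monoid.Coprod.inr) (p * φ w) by
    simpa using h 1 (.inl ⟨1, (map_one _).symm⟩)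
  induction w using Monoid.Coprod.induction_on with
  | inl a => exact fun p hp => hp.mul_left hij a
  | inr b => exact fun p hp => hp.mul_right hij b
  | mul x y hx hy =>
    intro p hp
    rw [map_mul, ← mul_assoc]
    exact hy _ (hx _ hp)

theorem amal_mk_inl_eq_mk_inr {A B C : Type*} [Group A] [Group B] [Group C] (f : C →* A)
    (g : C →* B) (c : C) :
    (QuotientGroup.mk (Monoid.Coprod.inl (f c)) : Amal f g) =
      QuotientGroup.mk (Monoid.Coprod.inr (g c)) := by
  rw [QuotientGroup.eq_iff_div_mem, div_eq_mul_inv]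
  exact Subgroup.subset_normalClosure ⟨c, rfl⟩

theorem hasNormalForm_amal
    (p : Amal (Subgroup.inclusion (inf_le_left : A ⊓ B ≤ A))
      (Subgroup.inclusion (inf_le_right : A ⊓ B ≤ B))) :
    HasNormalForm ((QuotientGroup.mk' _).comp Monoid.Coprod.inl)
      ((QuotientGroup.mk' _).comp Monoid.Coprod.inr) p := by
  obtain ⟨w, rfl⟩ := QuotientGroup.mk'_surjective _ p
  refine hasNormalForm_coprod _ ?_ w
  rintro ⟨a, ha⟩ ⟨b, hb⟩ (rfl : a = b)
  exact amal_mk_inl_eq_mk_inr (Subgroup.inclusion inf_le_left) (Subgroup.inclusion inf_le_right)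
    ⟨a, ha, hb⟩

end Amalgam

section Nagao

variable {K : Type*} [Field K]

theorem mem_GLconst_iff (M : GL (Fin 2) (Polynomial K)) :
    M ∈ GLconst K ↔ ∀ r s, (M r s).degree ≤ 0 := by
  constructor
  · rintro ⟨m, rfl⟩ r s
    simpa using Polynomial.degree_C_le
  · intro h
    refine ⟨Matrix.GeneralLinearGroup.map (Polynomial.evalRingHom 0) M, ?_⟩
    refine Units.ext (Matrix.ext fun r s => ?_)
    simp only [Matrix.GeneralLinearGroup.map_apply, Polynomial.coe_evalRingHom]
    rw [Polynomial.eq_C_of_degree_le_zero (h r s)]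
    simp

theorem mem_LowerTri_iff (M : GL (Fin 2) (Polynomial K)) : M ∈ LowerTri K ↔ M 0 1 = 0 :=
  Iff.rfl

theorem isUnit_diag_of_mem_LowerTri {M : GL (Fin 2) (Polynomial K)} (hM : M ∈ LowerTri K) :
    IsUnit (M 0 0) ∧ IsUnit (M 1 1) := by
  have h := (Matrix.isUnit_iff_isUnit_det _).1 M.isUnit
  rw [Matrix.det_fin_two, (mem_LowerTri_iff M).1 hM, zero_mul, sub_zero] at h
  exact IsUnit.mul_iff.1 h

theorem degree_pos_of_mem_LowerTri {M : GL (Fin 2) (Polynomial K)} (hM : M ∈ LowerTri K)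
    (hM' : M ∉ GLconst K) : 0 < (M 1 0).degree := by
  by_contra! h
  obtain ⟨h0, h1⟩ := isUnit_diag_of_mem_LowerTri hM
  refine hM' ((mem_GLconst_iff M).2 fun r s => ?_)
  fin_cases r <;> fin_cases s
  · exact (Polynomial.degree_eq_zero_of_isUnit h0).le
  · simp [(mem_LowerTri_iff M).1 hM]
  · exact h
  · exact (Polynomial.degree_eq_zero_of_isUnit h1).le

/-- The degree condition on the first row of a product of alternating letters. -/
def RowCondition (M : GL (Fin 2) (Polynomial K)) : Bool → Prop
  | true => M 0 1 ≠ 0 ∧ (M 0 0).degree ≤ (M 0 1).degree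
  | false => M 0 1 ≠ 0 ∧ (M 0 1).degree < (M 0 0).degree

theorem RowCondition.ne_zero {M : GL (Fin 2) (Polynomial K)} {s : Bool} (h : RowCondition M s) :
    M 0 1 ≠ 0 := by
  cases s <;> exact h.1

theorem rowCondition_mul_of_degree_lt {M N : GL (Fin 2) (Polynomial K)}
    (h : (M 0 1).degree < (M 0 0).degree) (hN : N ∈ GLconst K) (hN' : N ∉ LowerTri K) :
    RowCondition (M * N) true := by
  rw [mem_GLconst_iff] at hN
  rw [mem_LowerTri_iff] at hN'
  have hconst (p : Polynomial K) (r s : Fin 2) : (p * N r s).degree ≤ p.degree := by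
    rw [Polynomial.degree_mul]
    simpa using add_le_add_right (hN r s) p.degree
  have hN0 : (N 0 1).degree = 0 :=
    le_antisymm (hN 0 1) (Polynomial.zero_le_degree_iff.2 hN')
  have hy : ((M * N) 0 1).degree = (M 0 0).degree := by
    have h' : (M 0 0 * N 0 1).degree = (M 0 0).degree := by
      rw [Polynomial.degree_mul, hN0, add_zero]
    rw [Units.val_mul, Matrix.mul_apply, Fin.sum_univ_two, Polynomial.degree_add_eq_left_of_degree_lt, h']
    rw [h']
    exact (hconst _ _ _).trans_lt h
  refine ⟨fun h0 => ?_, ?_⟩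
  · rw [h0, Polynomial.degree_zero] at hy
    exact not_lt_bot (hy ▸ h)
  · rw [hy, Units.val_mul, Matrix.mul_apply, Fin.sum_univ_two]
    exact (Polynomial.degree_add_le _ _).trans
      (max_le (hconst _ _ _) ((hconst _ _ _).trans h.le))

theorem RowCondition.mul_lowerTri {M N : GL (Fin 2) (Polynomial K)}
    (h : RowCondition M true) (hN : N ∈ LowerTri K) (hN' : N ∉ GLconst K) :
    RowCondition (M * N) false := by
  obtain ⟨hy, hxy⟩ := h
  obtain ⟨h0, h1⟩ := isUnit_diag_of_mem_LowerTri hN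
  have hp := degree_pos_of_mem_LowerTri hN hN'
  have hy' : (M * N) 0 1 = M 0 1 * N 1 1 := by
    rw [Units.val_mul, Matrix.mul_apply, Fin.sum_univ_two, (mem_LowerTri_iff N).1 hN, mul_zero,
      zero_add]
  refine ⟨hy' ▸ mul_ne_zero hy h1.ne_zero, ?_⟩
  have hlt : (M 0 1).degree < (M 0 1 * N 1 0).degree := by
    rw [Polynomial.degree_mul]
    rw [Polynomial.degree_eq_natDegree hy,
      Polynomial.degree_eq_natDegree (Polynomial.ne_zero_of_degree_gt hp)] at *
    norm_cast at *
    lia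
  rw [hy', Units.val_mul, Matrix.mul_apply, Fin.sum_univ_two,
    Polynomial.degree_add_eq_right_of_degree_lt]
  · rwa [Polynomial.degree_mul, Polynomial.degree_eq_zero_of_isUnit h1, add_zero]
  · rw [Polynomial.degree_mul, Polynomial.degree_eq_zero_of_isUnit h0, add_zero]
    exact hxy.trans_lt hlt

theorem IsAlternating.rowCondition {P : Type*} [Group P] {i : GLconst K →* P}
    {j : LowerTri K →* P} (Φ : P →* GL (Fin 2) (Polynomial K)) (hi : ∀ a, Φ (i a) = a)
    (hj : ∀ b, Φ (j b) = b) {s : Bool} {p : P} (hp : IsAlternating i j s p) :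
    RowCondition (Φ p) s := by
  induction hp with
  | base b a ha =>
    rw [map_mul, hi, hj]
    refine rowCondition_mul_of_degree_lt ?_ a.2 ha
    rw [(mem_LowerTri_iff _).1 b.2, Polynomial.degree_zero, bot_lt_iff_ne_bot, Ne,
      Polynomial.degree_eq_bot]
    exact (isUnit_diag_of_mem_LowerTri b.2).1.ne_zero
  | snocLeft _ a ha ih =>
    rw [map_mul, hi]
    exact rowCondition_mul_of_degree_lt ih.2 a.2 ha
  | snocRight _ b hb ih =>
    rw [map_mul, hj]
    exact ih.mul_lowerTri b.2 hb

theorem exists_mem_sup_mul_entry (q : Polynomial K) :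
    ∃ N ∈ GLconst K ⊔ LowerTri K, ∀ M : GL (Fin 2) (Polynomial K),
      (M * N) 0 1 = M 0 0 - M 0 1 * q := by
  obtain ⟨E, hE⟩ : IsUnit !![1, 0; -q, 1] := (Matrix.isUnit_iff_isUnit_det _).2 (by simp)
  obtain ⟨W, hW⟩ : IsUnit (!![0, 1; 1, 0] : Matrix (Fin 2) (Fin 2) (Polynomial K)) :=
    (Matrix.isUnit_iff_isUnit_det _).2 (by simp)
  refine ⟨E * W, mul_mem (Subgroup.mem_sup_right ?_) (Subgroup.mem_sup_left ?_), fun M => ?_⟩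
  · rw [mem_LowerTri_iff, hE]
    simp
  · rw [mem_GLconst_iff, hW]
    intro r s
    fin_cases r <;> fin_cases s <;> simp
  · simp [hE, hW, Matrix.mul_apply, Fin.sum_univ_two, sub_eq_add_neg]

theorem GLconst_sup_LowerTri : GLconst K ⊔ LowerTri K = ⊤ := by
  refine (Subgroup.eq_top_iff' _).2 fun M => ?_
  induction hd : (M 0 1).degree using WellFoundedLT.induction generalizing M with
  | ind d ih =>
    by_cases h0 : M 0 1 = 0
    · exact Subgroup.mem_sup_right h0
    · obtain ⟨N, hN, h⟩ := exists_mem_sup_mul_entry (M 0 0 / M 0 1)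
      refine (Subgroup.mul_mem_cancel_right _ hN).1 (ih _ ?_ (M * N) rfl)
      rw [h M, ← EuclideanDomain.mod_eq_sub_mul_div, ← hd]
      exact EuclideanDomain.mod_lt _ h0

end Nagao

/-- Nagao's theorem: `GL₂(K[X]) = GL₂(K) *_{B₂(K)} B₂(K[X])`,
where `B₂(K) = GL₂(K) ∩ B₂(K[X])`. -/
theorem statement_16 {K : Type*} [Field K] :
    ∃ Φ : Amal (Subgroup.inclusion (inf_le_left : GLconst K ⊓ LowerTri K ≤ GLconst K))
            (Subgroup.inclusion (inf_le_right : GLconst K ⊓ LowerTri K ≤ LowerTri K)) →*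
          GL (Fin 2) (Polynomial K),
      (∀ a : GLconst K, Φ (QuotientGroup.mk (Monoid.Coprod.inl a)) = ↑a) ∧
      (∀ b : LowerTri K, Φ (QuotientGroup.mk (Monoid.Coprod.inr b)) = ↑b) ∧
      Function.Bijective Φ := by
  let f : Monoid.Coprod (GLconst K) (LowerTri K) →* GL (Fin 2) (Polynomial K) :=
    Monoid.Coprod.lift (GLconst K).subtype (LowerTri K).subtype
  let Φ : Amal (Subgroup.inclusion (inf_le_left : GLconst K ⊓ LowerTri K ≤ GLconst K))
      (Subgroup.inclusion (inf_le_right : GLconst K ⊓ LowerTri K ≤ LowerTri K)) →*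
      GL (Fin 2) (Polynomial K) :=
    QuotientGroup.lift _ f (Subgroup.normalClosure_le_normal (by
      rintro _ ⟨c, rfl⟩
      simp [f]))
  have hl (a : GLconst K) : Φ (QuotientGroup.mk (Monoid.Coprod.inl a)) = a := by
    simp [Φ, f]
  have hr (b : LowerTri K) : Φ (QuotientGroup.mk (Monoid.Coprod.inr b)) = b := by
    simp [Φ, f]
  refine ⟨Φ, hl, hr, (injective_iff_map_eq_one Φ).2 fun p hp => ?_, ?_⟩
  · rcases hasNormalForm_amal p with ⟨b, hb⟩ | ⟨s, hs⟩
    · have hb1 : b = 1 := Subtype.ext ((hr b).symm.trans ((congrArg Φ hb).symm.trans hp))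
      rw [hb, hb1, map_one]
    · refine absurd ?_ (hs.rowCondition Φ hl hr).ne_zero
      rw [hp]
      simp
  · rw [← MonoidHom.range_eq_top, eq_top_iff, ← GLconst_sup_LowerTri]
    exact sup_le (fun a ha => ⟨_, hl ⟨a, ha⟩⟩) fun b hb => ⟨_, hr ⟨b, hb⟩⟩

end
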